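/- Let p ∈ ℝ[X] be a monic polynomial of degree d ≥ 2, let a ≥ 1 and b ∈ ℤ be integers, and suppose the real number α is of finite type t for some t > 0. Suppose moreover that a ≤ N^{(2−2^{2−d})/(dt)}. Then for every ε > 0 there is a constant C > 0 (depending on α, d, t, ε but not on a, b, N) such that the discrepancy of the finite sequence (α·p(an+b))_{n=1}^N satisfies D_N((α p(an+b))_{n=1}^N) ≤ C · a^{dt/(2^{d−1}(t+1)+t)+ε} · N^{−(2−2^{2−d})/(2^{d−1}(2t+1)+t)+ε}. -/

import Mathlib

open Finset

/-- discrepancy of the finite sequence `(u_n)_{n=1}^N` -/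
noncomputable def disc (N : ℕ) (u : ℕ → ℝ) : ℝ :=
  sSup { D : ℝ | ∃ a b : ℝ, 0 ≤ a ∧ a < b ∧ b ≤ 1 ∧
    D = |((((Finset.Icc 1 N).filter
        (fun n => a ≤ Int.fract (u n) ∧ Int.fract (u n) < b)).card : ℝ) / N - (b - a))| }

/-- distance to the nearest integer -/
noncomputable def nid (x : ℝ) : ℝ := |x - round x|

/-- the real number `α` is of finite type `t` -/
def IsFiniteTypeReal (α t : ℝ) : Prop :=
  ∀ ε > 0, ∃ c > 0, ∀ n : ℤ, n ≠ 0 →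
    c ≤ (max 1 |(n : ℝ)|) ^ (t + ε) * nid ((n : ℝ) * α)

/-- The divisor bound `d(n) ≪ n ^ ε`. -/
lemma exists_card_divisors_le_rpow {ε : ℝ} (hε : 0 < ε) :
    ∃ C : ℝ, 0 < C ∧ ∀ n : ℕ, n ≠ 0 → (n.divisors.card : ℝ) ≤ C * (n : ℝ) ^ ε := by
  obtain ⟨P, hP⟩ := exists_nat_ge ((2 : ℝ) ^ (1 / ε))
  have hl : 0 < Real.log 2 := Real.log_pos one_lt_two
  set B : ℝ := max 1 (1 / (ε * Real.log 2)) with hB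
  have hB1 : 1 ≤ B := le_max_left _ _
  have hB2 : 1 ≤ B * (ε * Real.log 2) :=
    (div_le_iff₀ (by positivity)).1 (le_max_right _ _)
  refine ⟨B ^ P, by positivity, fun n hn => ?_⟩
  have key : ∀ q ∈ n.primeFactors, ((n.factorization q : ℝ) + 1) ≤
      (if q < P then B else 1) * ((q : ℝ) ^ n.factorization q) ^ ε := by
    intro q hq
    have hq2 : (2 : ℝ) ≤ q := by exact_mod_cast (Nat.prime_of_mem_primeFactors hq).two_le
    set v := n.factorization q
    have hsw : ((q : ℝ) ^ v) ^ ε = ((q : ℝ) ^ ε) ^ v := by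
      rw [← Real.rpow_natCast, ← Real.rpow_natCast, ← Real.rpow_mul (by positivity),
        ← Real.rpow_mul (by positivity), mul_comm]
    rw [hsw]
    split_ifs with h
    · have h1 : (1 : ℝ) + v * (ε * Real.log 2) ≤ ((q : ℝ) ^ ε) ^ v := by
        calc (1 : ℝ) + v * (ε * Real.log 2) ≤ Real.exp (v * (ε * Real.log 2)) := by
              linarith [Real.add_one_le_exp (v * (ε * Real.log 2))]
          _ = ((2 : ℝ) ^ ε) ^ v := by
              rw [Real.rpow_def_of_pos two_pos, ← Real.exp_nat_mul, mul_comm ε]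
          _ ≤ _ := by gcongr
      calc (v : ℝ) + 1 ≤ B * (1 + v * (ε * Real.log 2)) := by
            nlinarith [mul_le_mul_of_nonneg_left hB2 (Nat.cast_nonneg (α := ℝ) v)]
        _ ≤ _ := by gcongr
    · have h2 : (2 : ℝ) ≤ (q : ℝ) ^ ε := by
        have : (2 : ℝ) ^ (1 / ε) ≤ q := hP.trans (by exact_mod_cast not_lt.1 h)
        calc (2 : ℝ) = ((2 : ℝ) ^ (1 / ε)) ^ ε := by
              rw [← Real.rpow_mul (by norm_num), one_div_mul_cancel hε.ne', Real.rpow_one]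
          _ ≤ _ := by gcongr
      have h3 : ((v : ℝ) + 1) ≤ 2 ^ v := by exact_mod_cast Nat.lt_two_pow_self (n := v)
      rw [one_mul]
      exact h3.trans (by gcongr)
  calc (n.divisors.card : ℝ) = ∏ q ∈ n.primeFactors, ((n.factorization q : ℝ) + 1) := by
        rw [Nat.card_divisors hn]; push_cast; rfl
    _ ≤ ∏ q ∈ n.primeFactors, (if q < P then B else 1) * ((q : ℝ) ^ n.factorization q) ^ ε :=
        prod_le_prod (fun _ _ => by positivity) key
    _ = (∏ q ∈ n.primeFactors, if q < P then B else 1) * (n : ℝ) ^ ε := by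
        rw [prod_mul_distrib, Real.finsetProd_rpow _ _ (fun _ _ => by positivity)]
        congr 2
        exact_mod_cast Nat.prod_factorization_pow_eq_self hn
    _ ≤ B ^ P * (n : ℝ) ^ ε := by
        gcongr
        rw [← prod_filter, prod_const]
        refine pow_le_pow_right₀ hB1 ?_
        calc _ ≤ (range P).card := card_le_card fun q hq => by
                simpa using (mem_filter.1 hq).2
          _ = P := card_range P

/-- The second periodic Bernoulli function. -/
noncomputable def bernoulliTwo (x : ℝ) : ℝ := Int.fract x ^ 2 - Int.fract x + 1 / 6

lemma hasSum_bernoulliTwo (x : ℝ) :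
    HasSum (fun n : ℕ => 1 / (n : ℝ) ^ 2 * Real.cos (2 * Real.pi * (n * x)))
      (Real.pi ^ 2 * bernoulliTwo x) := by
  have h := hasSum_one_div_nat_pow_mul_cos one_ne_zero (x := Int.fract x)
    ⟨Int.fract_nonneg x, (Int.fract_lt_one x).le⟩
  convert h using 1
  · ext n
    congr 1
    have : 2 * Real.pi * (n * x) =
        2 * Real.pi * n * Int.fract x + ((n * ⌊x⌋ : ℤ) : ℝ) * (2 * Real.pi) := by
      conv_lhs => rw [← Int.fract_add_floor x]
      push_cast; ring
    rw [this, Real.cos_add_int_mul_two_pi]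
  · have : Polynomial.bernoulli 2 = Polynomial.X ^ 2 - Polynomial.X + Polynomial.C (1 / 6) := by
      rw [Polynomial.bernoulli_def]
      simp [sum_range_succ, bernoulli_one, bernoulli_two]
      rw [← Polynomial.C_mul_X_eq_monomial, ← Polynomial.C_mul_X_pow_eq_monomial]
      simp
      ring
    rw [mul_one, this]
    simp only [Polynomial.map_add, Polynomial.map_sub, Polynomial.map_pow, Polynomial.map_X,
      Polynomial.map_C, Polynomial.eval_add, Polynomial.eval_sub, Polynomial.eval_pow,
      Polynomial.eval_X, Polynomial.eval_C, bernoulliTwo]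
    norm_num [Nat.factorial]
    left
    ring

lemma fract_sub_le_bernoulliTwo {δ : ℝ} (hδ : 0 < δ) (hδ1 : δ ≤ 1) (x : ℝ) :
    Int.fract x - 1 / 2 ≤ 1 / (2 * δ) * (bernoulliTwo x - bernoulliTwo (x - δ)) + δ := by
  have h0 := Int.fract_nonneg x
  have h1 := Int.fract_lt_one x
  set z := Int.fract x with hz
  rw [← sub_le_iff_le_add, ← mul_le_mul_iff_right₀ (show 0 < 2 * δ by positivity), ← mul_assoc,
    mul_one_div_cancel (by positivity), one_mul]
  rcases le_or_gt δ z with h | h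
  · have : Int.fract (x - δ) = z - δ := by
      rw [Int.fract_eq_iff]
      exact ⟨by linarith, by linarith, ⌊x⌋, by rw [hz, Int.fract]; ring⟩
    rw [bernoulliTwo, bernoulliTwo, this, ← hz]
    nlinarith
  · have : Int.fract (x - δ) = z - δ + 1 := by
      rw [Int.fract_eq_iff]
      exact ⟨by linarith, by linarith, ⌊x⌋ - 1, by rw [hz, Int.fract]; push_cast; ring⟩
    rw [bernoulliTwo, bernoulliTwo, this, ← hz]
    nlinarith

lemma bernoulliTwo_le_fract_sub {δ : ℝ} (hδ : 0 < δ) (hδ1 : δ ≤ 1) (x : ℝ) :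
    1 / (2 * δ) * (bernoulliTwo (x + δ) - bernoulliTwo x) - δ ≤ Int.fract x - 1 / 2 := by
  have h0 := Int.fract_nonneg x
  have h1 := Int.fract_lt_one x
  set z := Int.fract x with hz
  rw [sub_le_iff_le_add, ← mul_le_mul_iff_right₀ (show 0 < 2 * δ by positivity), ← mul_assoc,
    mul_one_div_cancel (by positivity), one_mul]
  rcases lt_or_ge (z + δ) 1 with h | h
  · have : Int.fract (x + δ) = z + δ := by
      rw [Int.fract_eq_iff]
      exact ⟨by linarith, by linarith, ⌊x⌋, by rw [hz, Int.fract]; ring⟩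
    rw [bernoulliTwo, bernoulliTwo, this, ← hz]
    nlinarith
  · have : Int.fract (x + δ) = z + δ - 1 := by
      rw [Int.fract_eq_iff]
      exact ⟨by linarith, by linarith, ⌊x⌋ + 1, by rw [hz, Int.fract]; push_cast; ring⟩
    rw [bernoulliTwo, bernoulliTwo, this, ← hz]
    nlinarith

lemma indicator_eq_fract_sub_fract {a b x : ℝ} (ha : 0 ≤ a) (hab : a < b) (hb : b ≤ 1) :
    (if a ≤ Int.fract x ∧ Int.fract x < b then (1 : ℝ) else 0) - (b - a) =
      (Int.fract (x - b) - 1 / 2) - (Int.fract (x - a) - 1 / 2) := by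
  have h0 := Int.fract_nonneg x
  have h1 := Int.fract_lt_one x
  have key : ∀ c : ℝ, 0 ≤ c → c ≤ 1 → Int.fract (x - c) =
      Int.fract x - c + if Int.fract x < c then 1 else 0 := by
    intro c hc hc1
    rw [Int.fract_eq_iff]
    split_ifs with h
    · exact ⟨by linarith, by linarith, ⌊x⌋ - 1, by rw [Int.fract]; push_cast; ring⟩
    · exact ⟨by linarith, by linarith, ⌊x⌋, by rw [Int.fract]; ring⟩
  rw [key a ha (by linarith), key b (by linarith) hb]
  split_ifs <;> grind

/-- The additive character `x ↦ exp (2πix)`. -/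
noncomputable def unitExp (x : ℝ) : ℂ := Complex.exp ((2 * Real.pi * x : ℝ) * Complex.I)

lemma unitExp_add (x y : ℝ) : unitExp (x + y) = unitExp x * unitExp y := by
  rw [unitExp, unitExp, unitExp, ← Complex.exp_add]
  push_cast; ring_nf

@[simp] lemma norm_unitExp (x : ℝ) : ‖unitExp x‖ = 1 := Complex.norm_exp_ofReal_mul_I _

lemma unitExp_re (x : ℝ) : (unitExp x).re = Real.cos (2 * Real.pi * x) :=
  Complex.exp_ofReal_mul_I_re _

lemma unitExp_int (n : ℤ) : unitExp n = 1 := by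
  rw [unitExp, Complex.exp_eq_one_iff]
  exact ⟨n, by push_cast; ring⟩

lemma unitExp_neg (x : ℝ) : unitExp (-x) = (starRingEnd ℂ) (unitExp x) := by
  rw [unitExp, unitExp, ← Complex.exp_conj, map_mul, Complex.conj_ofReal, Complex.conj_I]
  push_cast; ring_nf

lemma norm_unitExp_sub_one (x : ℝ) : ‖unitExp x - 1‖ = 2 * |Real.sin (Real.pi * x)| := by
  have := Complex.norm_exp_I_mul_ofReal_sub_one (2 * Real.pi * x)
  rw [unitExp, mul_comm, this, norm_mul, Real.norm_eq_abs, Real.norm_eq_abs, abs_two]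
  ring_nf

lemma norm_unitExp_sub_one_le_rpow {x θ : ℝ} (hx : 0 < x) (h0 : 0 ≤ θ) (h1 : θ ≤ 1) :
    ‖unitExp x - 1‖ ≤ 2 * Real.pi * x ^ θ := by
  rw [norm_unitExp_sub_one, mul_assoc]
  gcongr
  rcases le_total x 1 with h | h
  · calc |Real.sin (Real.pi * x)| ≤ |Real.pi * x| := Real.abs_sin_le_abs
      _ = Real.pi * x ^ (1 : ℝ) := by rw [abs_of_pos (by positivity), Real.rpow_one]
      _ ≤ _ := by
        gcongr 1
        exact Real.rpow_le_rpow_of_exponent_ge hx h h1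
  · calc |Real.sin (Real.pi * x)| ≤ 1 := Real.abs_sin_le_one _
      _ ≤ Real.pi * 1 := by linarith [Real.pi_gt_three]
      _ ≤ _ := by gcongr; exact Real.one_le_rpow h h0

section Smoothing

variable {N : ℕ} {u : ℕ → ℝ} {E s η δ : ℝ}

lemma abs_sum_bernoulliTwo_le (hs : 0 ≤ s) (hη : 0 < η) (hsη : s + η ≤ 1)
    (hδ : 0 < δ)
    (h : ∀ k : ℕ, 1 ≤ k → ‖∑ n ∈ Icc 1 N, unitExp (k * u n)‖ ≤ N * (E * (k : ℝ) ^ s)) (c : ℝ) :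
    |1 / (2 * δ) * ∑ n ∈ Icc 1 N, (bernoulliTwo (u n - c + δ) - bernoulliTwo (u n - c))| ≤
      N * (E * δ ^ (-(s + η)) * ∑' k : ℕ, (k : ℝ) ^ (-(1 + η))) := by
  have hZ : Summable fun k : ℕ => (k : ℝ) ^ (-(1 + η)) :=
    Real.summable_nat_rpow.2 (by linarith)
  set Z := ∑' k : ℕ, (k : ℝ) ^ (-(1 + η)) with hZdef
  have hZ0 : 0 ≤ Z := tsum_nonneg fun k => by positivity
  set T := ∑ n ∈ Icc 1 N, (bernoulliTwo (u n - c + δ) - bernoulliTwo (u n - c)) with hT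
  have hsum : HasSum (fun k : ℕ => ∑ n ∈ Icc 1 N,
      (1 / (k : ℝ) ^ 2 * Real.cos (2 * Real.pi * (k * (u n - c + δ))) -
        1 / (k : ℝ) ^ 2 * Real.cos (2 * Real.pi * (k * (u n - c))))) (Real.pi ^ 2 * T) := by
    rw [hT, mul_sum]
    refine hasSum_sum fun n _ => ?_
    rw [mul_sub]
    exact (hasSum_bernoulliTwo _).sub (hasSum_bernoulliTwo _)
  have hterm : ∀ k : ℕ, ‖∑ n ∈ Icc 1 N,
      (1 / (k : ℝ) ^ 2 * Real.cos (2 * Real.pi * (k * (u n - c + δ))) -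
        1 / (k : ℝ) ^ 2 * Real.cos (2 * Real.pi * (k * (u n - c))))‖ ≤
      (2 * Real.pi * N * E * δ ^ (1 - s - η)) * (k : ℝ) ^ (-(1 + η)) := by
    intro k
    rcases Nat.eq_zero_or_pos k with rfl | hk
    · simp
      rw [Real.zero_rpow (by linarith)]
      simp
    have hk' : (0 : ℝ) < k := by exact_mod_cast hk
    have hre : ∑ n ∈ Icc 1 N,
      (1 / (k : ℝ) ^ 2 * Real.cos (2 * Real.pi * (k * (u n - c + δ))) -
        1 / (k : ℝ) ^ 2 * Real.cos (2 * Real.pi * (k * (u n - c)))) =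
        1 / (k : ℝ) ^ 2 * ((unitExp (k * δ) - 1) * unitExp (-(k * c)) *
          ∑ n ∈ Icc 1 N, unitExp (k * u n)).re := by
      rw [mul_sum, Complex.re_sum, mul_sum]
      refine sum_congr rfl fun n _ => ?_
      rw [← mul_sub, ← unitExp_re, ← unitExp_re, ← Complex.sub_re]
      congr 2
      rw [show (k : ℝ) * (u n - c + δ) = k * δ + -(k * c) + k * u n by ring,
        show (k : ℝ) * (u n - c) = -(k * c) + k * u n by ring,
        unitExp_add, unitExp_add, unitExp_add]
      ring
    rw [hre, Real.norm_eq_abs, abs_mul, abs_of_nonneg (by positivity)]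
    calc 1 / (k : ℝ) ^ 2 * |((unitExp (k * δ) - 1) * unitExp (-(k * c)) *
          ∑ n ∈ Icc 1 N, unitExp (k * u n)).re|
        ≤ 1 / (k : ℝ) ^ 2 * ((2 * Real.pi * (k * δ) ^ (1 - s - η)) * (N * (E * (k : ℝ) ^ s))) := by
          gcongr
          refine (Complex.abs_re_le_norm _).trans ?_
          rw [norm_mul, norm_mul, norm_unitExp, mul_one]
          gcongr
          · exact norm_unitExp_sub_one_le_rpow (by positivity) (by linarith) (by linarith)
          · exact h k hk
      _ = (2 * Real.pi * N * E * δ ^ (1 - s - η)) *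
            ((k : ℝ) ^ (-2 : ℝ) * (k : ℝ) ^ (1 - s - η) * (k : ℝ) ^ s) := by
          rw [Real.mul_rpow hk'.le hδ.le, Real.rpow_neg hk'.le, Real.rpow_two]
          ring
      _ = _ := by
          rw [← Real.rpow_add hk', ← Real.rpow_add hk']
          ring_nf
  have hbd := hsum.norm_le_of_bounded (hZ.hasSum.mul_left
    (2 * Real.pi * N * E * δ ^ (1 - s - η))) hterm
  rw [Real.norm_eq_abs, abs_mul, abs_of_pos (by positivity), ← hZdef] at hbd
  rw [abs_mul, abs_of_pos (by positivity)]
  have hpi := Real.pi_gt_three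
  have hsplit : δ ^ (-(s + η)) = δ ^ (1 - s - η) / δ := by
    rw [show -(s + η) = (1 - s - η) - 1 by ring, Real.rpow_sub_one hδ.ne']
  rw [hsplit]
  have h3 : Real.pi * |T| ≤ 2 * N * E * δ ^ (1 - s - η) * Z := by
    refine le_of_mul_le_mul_left ?_ Real.pi_pos
    linarith
  have h4 : |T| ≤ 2 * N * E * δ ^ (1 - s - η) * Z := by nlinarith [abs_nonneg T]
  calc 1 / (2 * δ) * |T| ≤ 1 / (2 * δ) * (2 * N * E * δ ^ (1 - s - η) * Z) := by gcongr
    _ = _ := by field_simp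

lemma abs_sum_fract_sub_le (hs : 0 ≤ s) (hη : 0 < η) (hsη : s + η ≤ 1)
    (hδ : 0 < δ) (hδ1 : δ ≤ 1)
    (h : ∀ k : ℕ, 1 ≤ k → ‖∑ n ∈ Icc 1 N, unitExp (k * u n)‖ ≤ N * (E * (k : ℝ) ^ s)) (c : ℝ) :
    |∑ n ∈ Icc 1 N, (Int.fract (u n - c) - 1 / 2)| ≤
      N * (δ + E * δ ^ (-(s + η)) * ∑' k : ℕ, (k : ℝ) ^ (-(1 + η))) := by
  have key := abs_sum_bernoulliTwo_le hs hη hsη hδ h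
  rw [abs_le, mul_add]
  constructor
  · have h1 := (abs_le.1 (key c)).1
    have h2 := sum_le_sum fun n (_ : n ∈ Icc 1 N) => bernoulliTwo_le_fract_sub hδ hδ1 (u n - c)
    rw [sum_sub_distrib, ← mul_sum, sum_const, Nat.card_Icc, nsmul_eq_mul] at h2
    simp only [Nat.add_sub_cancel] at h2
    linarith
  · have h1 := (abs_le.1 (key (c + δ))).2
    have h2 := sum_le_sum fun n (_ : n ∈ Icc 1 N) => fract_sub_le_bernoulliTwo hδ hδ1 (u n - c)
    rw [sum_add_distrib, ← mul_sum, sum_const, Nat.card_Icc, nsmul_eq_mul] at h2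
    simp only [Nat.add_sub_cancel] at h2
    simp only [← sub_sub, sub_add_cancel] at h1
    linarith

lemma disc_le_of_abs_le {B : ℝ} (h : ∀ a b : ℝ, 0 ≤ a → a < b → b ≤ 1 →
    |((((Icc 1 N).filter
        (fun n => a ≤ Int.fract (u n) ∧ Int.fract (u n) < b)).card : ℝ) / N - (b - a))| ≤ B) :
    disc N u ≤ B := by
  refine csSup_le ⟨_, 0, 1, le_rfl, one_pos, le_rfl, rfl⟩ ?_
  rintro D ⟨a, b, ha, hab, hb, rfl⟩
  exact h a b ha hab hb

lemma disc_le_one : disc N u ≤ 1 := by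
  refine disc_le_of_abs_le fun a b ha hab hb => ?_
  have h1 : ((((Icc 1 N).filter
        (fun n => a ≤ Int.fract (u n) ∧ Int.fract (u n) < b)).card : ℝ) / N) ≤ 1 := by
    refine div_le_one_of_le₀ ?_ (Nat.cast_nonneg _)
    exact_mod_cast (card_filter_le _ _).trans (by simp)
  have h0 : 0 ≤ ((((Icc 1 N).filter
        (fun n => a ≤ Int.fract (u n) ∧ Int.fract (u n) < b)).card : ℝ) / N) := by positivity
  rw [abs_le]
  constructor <;> linarith

/-- An Erdős–Turán type inequality for sequences whose exponential sums with frequency `k` are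
bounded by a power of `k`. -/
lemma disc_le_of_norm_sum_le (hN : 1 ≤ N) (hs : 0 ≤ s) (hη : 0 < η)
    (hsη : s + η ≤ 1) (hδ : 0 < δ) (hδ1 : δ ≤ 1)
    (h : ∀ k : ℕ, 1 ≤ k → ‖∑ n ∈ Icc 1 N, unitExp (k * u n)‖ ≤ N * (E * (k : ℝ) ^ s)) :
    disc N u ≤ 2 * (δ + E * δ ^ (-(s + η)) * ∑' k : ℕ, (k : ℝ) ^ (-(1 + η))) := by
  have hN' : (0 : ℝ) < N := by exact_mod_cast hN
  refine disc_le_of_abs_le fun a b ha hab hb => ?_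
  have key := abs_sum_fract_sub_le hs hη hsη hδ hδ1 h
  have hcard : (((Icc 1 N).filter
        (fun n => a ≤ Int.fract (u n) ∧ Int.fract (u n) < b)).card : ℝ) - N * (b - a) =
      ∑ n ∈ Icc 1 N, (Int.fract (u n - b) - 1 / 2) -
        ∑ n ∈ Icc 1 N, (Int.fract (u n - a) - 1 / 2) := by
    rw [← sum_sub_distrib, ← sum_congr rfl fun n _ => indicator_eq_fract_sub_fract ha hab hb,
      sum_sub_distrib, sum_boole, sum_const, Nat.card_Icc, nsmul_eq_mul, Nat.add_sub_cancel]
  have : (((Icc 1 N).filter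
        (fun n => a ≤ Int.fract (u n) ∧ Int.fract (u n) < b)).card : ℝ) / N - (b - a) =
      (∑ n ∈ Icc 1 N, (Int.fract (u n - b) - 1 / 2) -
        ∑ n ∈ Icc 1 N, (Int.fract (u n - a) - 1 / 2)) / N := by
    rw [← hcard]; field_simp
  rw [this, abs_div, abs_of_pos hN', div_le_iff₀ hN']
  have h3 := abs_sub (∑ n ∈ Icc 1 N, (Int.fract (u n - b) - 1 / 2))
    (∑ n ∈ Icc 1 N, (Int.fract (u n - a) - 1 / 2))
  linarith [key a, key b]

end Smoothing

/-- `IsPhase k c f` says that all `k`-fold differences of `f` are the constant `c` times the product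
of the steps. -/
def IsPhase : ℕ → ℝ → (ℤ → ℝ) → Prop
  | 0, c, f => ∀ n, f n = c
  | k + 1, c, f => ∀ h : ℤ, IsPhase k (h * c) fun n => f (n + h) - f n

/-- The sum of `g (h₁ ⋯ h_k)` over all `h₁, …, h_k` with `|hᵢ| < N`. -/
noncomputable def multSum (N : ℕ) : ℕ → (ℤ → ℝ) → ℝ
  | 0, g => g 1
  | k + 1, g => ∑ h ∈ Ioo (-N : ℤ) N, multSum N k fun m => g (h * m)

lemma card_Ioo_neg_le (N : ℕ) : ((Ioo (-N : ℤ) N).card : ℝ) ≤ 2 * N := by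
  rw [Int.card_Ioo]
  exact_mod_cast (by lia : ((N : ℤ) - -N - 1).toNat ≤ 2 * N)

lemma norm_sq_sum_unitExp_le {N : ℕ} {u v : ℤ} (huv : v - u ≤ N) (f : ℤ → ℝ) :
    ‖∑ n ∈ Ico u v, unitExp (f n)‖ ^ 2 ≤ ∑ h ∈ Ioo (-N : ℤ) N,
      ‖∑ n ∈ Ico (max u (u - h)) (min v (v - h)), unitExp (f (n + h) - f n)‖ := by
  have hexp : ∀ n ∈ Ico u v, ∑ m ∈ Ico u v, unitExp (f m - f n) =
      ∑ h ∈ Ioo (-N : ℤ) N, if n + h ∈ Ico u v then unitExp (f (n + h) - f n) else 0 := by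
    intro n hn
    rw [← sum_filter]
    rw [mem_Ico] at hn
    refine sum_nbij' (fun m => m - n) (fun h => n + h) ?_ ?_ ?_ ?_ ?_
    · intro m hm; simp only [mem_filter, mem_Ioo, mem_Ico] at *; lia
    · intro h hh; exact (mem_filter.1 hh).2
    · intro m _; lia
    · intro h _; lia
    · intro m _; simp
  have heq : ((‖∑ n ∈ Ico u v, unitExp (f n)‖ ^ 2 : ℝ) : ℂ) = ∑ h ∈ Ioo (-N : ℤ) N,
      ∑ n ∈ Ico (max u (u - h)) (min v (v - h)), unitExp (f (n + h) - f n) := by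
    calc ((‖∑ n ∈ Ico u v, unitExp (f n)‖ ^ 2 : ℝ) : ℂ)
        = (∑ m ∈ Ico u v, unitExp (f m)) * (starRingEnd ℂ) (∑ n ∈ Ico u v, unitExp (f n)) := by
          rw [Complex.mul_conj']; norm_cast
      _ = ∑ n ∈ Ico u v, ∑ m ∈ Ico u v, unitExp (f m - f n) := by
          rw [map_sum, sum_mul_sum, sum_comm]
          refine sum_congr rfl fun n _ => sum_congr rfl fun m _ => ?_
          rw [← unitExp_neg, ← unitExp_add, sub_eq_add_neg]
      _ = ∑ h ∈ Ioo (-N : ℤ) N, ∑ n ∈ Ico u v,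
            if n + h ∈ Ico u v then unitExp (f (n + h) - f n) else 0 := by
          rw [sum_congr rfl hexp, sum_comm]
      _ = _ := by
          refine sum_congr rfl fun h _ => ?_
          rw [← sum_filter]
          refine sum_congr ?_ fun _ _ => rfl
          ext n
          simp only [mem_filter, mem_Ico]
          lia
  calc ‖∑ n ∈ Ico u v, unitExp (f n)‖ ^ 2
      = ‖((‖∑ n ∈ Ico u v, unitExp (f n)‖ ^ 2 : ℝ) : ℂ)‖ := by
        rw [Complex.norm_real, Real.norm_eq_abs, abs_of_nonneg (by positivity)]
    _ ≤ _ := by rw [heq]; exact norm_sum_le _ _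

lemma nid_nonneg (x : ℝ) : 0 ≤ nid x := abs_nonneg _

lemma nid_le_half (x : ℝ) : nid x ≤ 1 / 2 := abs_sub_round x

lemma nid_le_abs_sub_int (x : ℝ) (n : ℤ) : nid x ≤ |x - n| := round_le x n

lemma nid_neg (x : ℝ) : nid (-x) = nid x := by
  have h : ∀ y, nid (-y) ≤ nid y := fun y => by
    refine (nid_le_abs_sub_int (-y) (-round y)).trans_eq ?_
    rw [nid, ← abs_neg]
    congr 1
    push_cast; ring
  exact le_antisymm (h x) (by simpa using h (-x))

lemma two_mul_nid_le_norm (x : ℝ) : 2 * nid x ≤ ‖unitExp x - 1‖ := by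
  have h1 : unitExp x = unitExp (x - round x) := by
    conv_lhs => rw [← sub_add_cancel x (round x : ℝ), unitExp_add, unitExp_int, mul_one]
  have h2 := Real.mul_abs_le_abs_sin (x := Real.pi * (x - round x)) (by
    rw [abs_mul, abs_of_pos Real.pi_pos]
    nlinarith [nid_le_half x, Real.pi_pos, show nid x = |x - round x| from rfl])
  rw [h1, norm_unitExp_sub_one]
  rw [abs_mul, abs_of_pos Real.pi_pos, ← mul_assoc, div_mul_cancel₀ _ Real.pi_ne_zero] at h2
  rw [nid]
  linarith [abs_nonneg (x - round x)]

/-- A smooth substitute for the usual bound `min N ‖x‖⁻¹` of a geometric sum. -/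
noncomputable def geomBound (N : ℕ) (y : ℝ) : ℝ := 2 * N / (1 + N * y)

lemma geomBound_nonneg (N : ℕ) {y : ℝ} (hy : 0 ≤ y) : 0 ≤ geomBound N y := by
  rw [geomBound]; positivity

lemma geomBound_anti (N : ℕ) {x y : ℝ} (hx : 0 ≤ x) (hxy : x ≤ y) :
    geomBound N y ≤ geomBound N x := by
  rw [geomBound, geomBound]; gcongr

lemma norm_geom_sum_le {N : ℕ} (hN : 1 ≤ N) {u v : ℤ} (huv : v - u ≤ N) {c : ℝ} {f : ℤ → ℝ}
    (hf : ∀ n, f (n + 1) - f n = c) :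
    ‖∑ n ∈ Ico u v, unitExp (f n)‖ ≤ geomBound N (nid c) := by
  have hc := nid_nonneg c
  rw [geomBound]
  rw [le_div_iff₀ (by positivity)]
  set S := ∑ n ∈ Ico u v, unitExp (f n) with hS
  have h1 : ‖S‖ ≤ N := by
    refine (norm_sum_le _ _).trans ?_
    simp only [norm_unitExp, sum_const, Int.card_Ico, nsmul_eq_mul, mul_one]
    exact_mod_cast (by lia : (v - u).toNat ≤ N)
  have h2 : ‖S‖ * ‖unitExp c - 1‖ ≤ 2 := by
    rcases le_or_gt v u with h | h
    · simp [hS, Ico_eq_empty_of_le h]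
    have : S * (unitExp c - 1) = unitExp (f v) - unitExp (f u) := by
      rw [hS, sum_mul]
      calc ∑ n ∈ Ico u v, unitExp (f n) * (unitExp c - 1)
          = ∑ n ∈ Ico u v, (unitExp (f (n + 1)) - unitExp (f n)) := by
            refine sum_congr rfl fun n _ => ?_
            rw [mul_sub, ← unitExp_add, ← hf n]
            simp
        _ = _ := by
            have hle := h.le
            clear h h1 hS huv S
            induction v, hle using Int.leInduction with
            | base => simp
            | succ w hw ih =>
              rw [← insert_Ico_right_eq_Ico_add_one hw, sum_insert (by simp), ih]
              ring
    rw [← norm_mul, this]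
    refine (norm_sub_le _ _).trans ?_
    simp only [norm_unitExp]; norm_num
  have h3 : ‖S‖ * nid c ≤ 1 := by
    nlinarith [two_mul_nid_le_norm c, norm_nonneg S]
  nlinarith [Nat.cast_nonneg (α := ℝ) N]

lemma norm_sum_unitExp_pow_le {N : ℕ} (hN : 1 ≤ N) (k : ℕ) : ∀ {u v : ℤ}, v - u ≤ N →
    ∀ {c : ℝ} {f : ℤ → ℝ}, IsPhase (k + 1) c f →
    ‖∑ n ∈ Ico u v, unitExp (f n)‖ ^ 2 ^ k ≤ (2 * N : ℝ) ^ (2 ^ k - k - 1) *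
      multSum N k fun m => geomBound N (nid (m * c)) := by
  induction k with
  | zero =>
    intro u v huv c f hf
    simpa [multSum] using norm_geom_sum_le hN huv (c := c) (f := f) fun n => by simpa using hf 1 n
  | succ k ih =>
    intro u v huv c f hf
    have hk : k + 1 ≤ 2 ^ k := Nat.lt_two_pow_self
    set F : ℤ → ℝ := fun h =>
      ‖∑ n ∈ Ico (max u (u - h)) (min v (v - h)), unitExp (f (n + h) - f n)‖
    calc ‖∑ n ∈ Ico u v, unitExp (f n)‖ ^ 2 ^ (k + 1)
        = (‖∑ n ∈ Ico u v, unitExp (f n)‖ ^ 2) ^ 2 ^ k := by rw [← pow_mul, pow_succ' 2 k]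
      _ ≤ (∑ h ∈ Ioo (-N : ℤ) N, F h) ^ 2 ^ k := by
          gcongr; exact norm_sq_sum_unitExp_le huv f
      _ = (∑ h ∈ Ioo (-N : ℤ) N, F h) ^ (2 ^ k - 1 + 1) := by
          rw [Nat.sub_add_cancel (by lia)]
      _ ≤ ((Ioo (-N : ℤ) N).card : ℝ) ^ (2 ^ k - 1) *
            ∑ h ∈ Ioo (-N : ℤ) N, F h ^ (2 ^ k - 1 + 1) := by
          have := pow_sum_div_card_le_sum_pow (s := Ioo (-N : ℤ) N) (f := F)
            (fun h _ => norm_nonneg _) (2 ^ k - 1)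
          rwa [div_le_iff₀' (by
            have : 0 < (Ioo (-N : ℤ) N).card := card_pos.2 ⟨0, by simp; lia⟩
            positivity)] at this
      _ ≤ (2 * N : ℝ) ^ (2 ^ k - 1) * ∑ h ∈ Ioo (-N : ℤ) N, (2 * N : ℝ) ^ (2 ^ k - k - 1) *
            multSum N k fun m => geomBound N (nid (m * (h * c))) := by
          rw [Nat.sub_add_cancel (by lia)]
          gcongr with h _
          · exact card_Ioo_neg_le N
          · exact ih (by lia) (hf h)
      _ = _ := by
          rw [← mul_sum, ← mul_assoc, ← pow_add, multSum]
          congr 2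
          · rw [pow_succ]; lia
          · funext h
            congr 1
            funext m
            rw [Int.cast_mul, mul_left_comm, mul_assoc]

lemma isPhase_polynomial (k : ℕ) : ∀ {f : Polynomial ℝ}, f.natDegree ≤ k →
    IsPhase k (k.factorial * f.coeff k) fun n : ℤ => f.eval (n : ℝ) := by
  induction k with
  | zero =>
    intro f hf n
    rw [Polynomial.eq_C_of_natDegree_le_zero hf]
    simp
  | succ k ih =>
    intro f hf h
    have hc : (Polynomial.taylor (h : ℝ) f - f).coeff k = h * ((k + 1) * f.coeff (k + 1)) := by
      have h1 : (Polynomial.hasseDeriv k f).natDegree < 2 :=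
        (Polynomial.natDegree_hasseDeriv_le f k).trans_lt (by lia)
      rw [Polynomial.coeff_sub, Polynomial.taylor_coeff, Polynomial.eval_eq_sum_range' h1,
        sum_range_succ, sum_range_one, Polynomial.hasseDeriv_coeff, Polynomial.hasseDeriv_coeff,
        add_comm 1 k, Nat.choose_succ_self_right, zero_add, Nat.choose_self]
      push_cast; ring
    have hdeg : (Polynomial.taylor (h : ℝ) f - f).natDegree ≤ k := by
      rw [Polynomial.natDegree_le_iff_coeff_eq_zero]
      intro m hm
      rw [Polynomial.coeff_sub]
      rcases lt_or_ge f.natDegree m with h1 | h1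
      · rw [Polynomial.coeff_eq_zero_of_natDegree_lt h1,
          Polynomial.coeff_eq_zero_of_natDegree_lt (by rwa [Polynomial.natDegree_taylor]), sub_zero]
      · obtain rfl : m = f.natDegree := by lia
        rw [Polynomial.coeff_taylor_natDegree, Polynomial.leadingCoeff, sub_self]
    have := ih hdeg
    rw [hc] at this
    convert this using 1
    · rw [Nat.factorial_succ]; push_cast; ring
    · ext n
      rw [Polynomial.eval_sub, Polynomial.taylor_eval]
      push_cast; rfl

lemma multSum_const_le (N k : ℕ) {x : ℝ} (hx : 0 ≤ x) :
    multSum N k (fun _ => x) ≤ (2 * N) ^ k * x := by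
  have h : ∀ k, multSum N k (fun _ => x) = ((Ioo (-N : ℤ) N).card : ℝ) ^ k * x := by
    intro k
    induction k with
    | zero => simp [multSum]
    | succ k ih => rw [multSum, ih, sum_const, nsmul_eq_mul, pow_succ', mul_assoc]
  rw [h]
  gcongr
  exact card_Ioo_neg_le N

/-- The nonzero integers of absolute value at most `M`. -/
noncomputable def punctured (M : ℕ) : Finset ℤ := (Icc (-M : ℤ) M).erase 0

lemma mem_punctured {M : ℕ} {m : ℤ} : m ∈ punctured M ↔ m ≠ 0 ∧ m.natAbs ≤ M := by
  rw [punctured, mem_erase, mem_Icc]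
  lia

lemma card_filter_mul_eq_le (A B : Finset ℤ) {m : ℤ} (hm : m ≠ 0) :
    ((A ×ˢ B).filter fun z => z.1 * z.2 = m).card ≤ 2 * m.natAbs.divisors.card := by
  have : (m.natAbs.divisors ×ˢ (univ : Finset Bool)).card = 2 * m.natAbs.divisors.card := by
    rw [card_product, mul_comm]; rfl
  rw [← this]
  refine card_le_card_of_injOn (fun z => (z.1.natAbs, decide (0 < z.1))) ?_ ?_
  · intro z hz
    have hz' := (mem_filter.1 hz).2
    simp only [coe_product, Set.mem_prod, mem_coe, Nat.mem_divisors, mem_univ, and_true]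
    exact ⟨Int.natAbs_dvd_natAbs.2 ⟨z.2, hz'.symm⟩, by simpa using hm⟩
  · rintro ⟨x, y⟩ hz ⟨x', y'⟩ hz' h
    have h1 : x * y = m := (mem_filter.1 hz).2
    have h2 : x' * y' = m := (mem_filter.1 hz').2
    simp only [Prod.mk.injEq, decide_eq_decide] at h
    have hx : x = x' := by
      rcases eq_or_ne x 0 with rfl | h0
      · simp at h1; exact absurd h1.symm hm
      lia
    subst hx
    have hx0 : x ≠ 0 := by rintro rfl; simp at h1; exact hm h1.symm
    rw [mul_left_cancel₀ hx0 (h1.trans h2.symm)]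

lemma exists_sum_mul_le {ε : ℝ} (hε : 0 < ε) (k : ℕ) :
    ∃ C : ℝ, 0 < C ∧ ∀ N : ℕ, 1 ≤ N → ∀ g : ℤ → ℝ, (∀ m, 0 ≤ g m) →
      ∑ h ∈ (Ioo (-N : ℤ) N).erase 0, ∑ m ∈ punctured (N ^ k), g (h * m) ≤
        C * (N : ℝ) ^ ε * ∑ m ∈ punctured (N ^ (k + 1)), g m := by
  obtain ⟨C, hC, hd⟩ := exists_card_divisors_le_rpow (ε := ε / (k + 1)) (by positivity)
  refine ⟨2 * C, by positivity, fun N hN g hg => ?_⟩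
  have hN' : (1 : ℝ) ≤ N := by exact_mod_cast hN
  set A := (Ioo (-N : ℤ) N).erase 0
  set B := punctured (N ^ k)
  have hmaps : ∀ z ∈ A ×ˢ B, z.1 * z.2 ∈ punctured (N ^ (k + 1)) := by
    intro z hz
    rw [mem_product, mem_erase, mem_Ioo, mem_punctured] at hz
    rw [mem_punctured, Int.natAbs_mul, pow_succ']
    exact ⟨mul_ne_zero hz.1.1 hz.2.1, Nat.mul_le_mul (by lia) hz.2.2⟩
  rw [← sum_product', ← sum_fiberwise_of_maps_to hmaps, mul_sum]
  refine sum_le_sum fun m hm => ?_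
  rw [mem_punctured] at hm
  calc ∑ z ∈ (A ×ˢ B).filter (fun z => z.1 * z.2 = m), g (z.1 * z.2)
      = ((A ×ˢ B).filter fun z => z.1 * z.2 = m).card * g m := by
        rw [sum_congr rfl fun z hz => by rw [(mem_filter.1 hz).2], sum_const, nsmul_eq_mul]
    _ ≤ 2 * C * (N : ℝ) ^ ε * g m := by
        gcongr
        · exact hg m
        calc (((A ×ˢ B).filter fun z => z.1 * z.2 = m).card : ℝ)
            ≤ 2 * m.natAbs.divisors.card := by exact_mod_cast card_filter_mul_eq_le A B hm.1
          _ ≤ 2 * (C * (m.natAbs : ℝ) ^ (ε / (k + 1))) := by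
              gcongr; exact hd _ (by simpa using hm.1)
          _ ≤ 2 * (C * ((N : ℝ) ^ (k + 1)) ^ (ε / (k + 1))) := by
              gcongr; exact_mod_cast hm.2
          _ = _ := by
              rw [← Real.rpow_natCast, ← Real.rpow_mul (by positivity)]
              push_cast
              rw [mul_div_cancel₀ _ (by positivity)]
              ring

lemma exists_multSum_le (k : ℕ) : ∀ {ε : ℝ}, 0 < ε →
    ∃ C : ℝ, 0 < C ∧ ∀ N : ℕ, 1 ≤ N → ∀ g : ℤ → ℝ, (∀ m, 0 ≤ g m) →
      multSum N k g ≤ k * (2 * N) ^ (k - 1) * g 0 +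
        C * (N : ℝ) ^ ε * ∑ m ∈ punctured (N ^ k), g m := by
  induction k with
  | zero =>
    intro ε hε
    refine ⟨1, one_pos, fun N hN g hg => ?_⟩
    have hN' : (1 : ℝ) ≤ N := by exact_mod_cast hN
    have h1 : g 1 ≤ ∑ m ∈ punctured (N ^ 0), g m :=
      single_le_sum (fun m _ => hg m) (mem_punctured.2 (by simp))
    have h2 : 0 ≤ g 1 := hg 1
    have h3 := Real.one_le_rpow hN' hε.le
    simp only [multSum, Nat.cast_zero, zero_mul, zero_add, one_mul]
    nlinarith
  | succ k ih =>
    intro ε hε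
    obtain ⟨C₁, hC₁, h₁⟩ := ih (half_pos hε)
    obtain ⟨C₂, hC₂, h₂⟩ := exists_sum_mul_le (half_pos hε) k
    refine ⟨C₁ * C₂, by positivity, fun N hN g hg => ?_⟩
    have hN' : (0 : ℝ) < N := by exact_mod_cast hN
    have hcard : (((Ioo (-N : ℤ) N).erase 0).card : ℝ) ≤ 2 * N :=
      le_trans (by exact_mod_cast card_erase_le) (card_Ioo_neg_le N)
    have hpow : (k : ℝ) * (2 * N : ℝ) ^ (k - 1) * (2 * N) = k * (2 * N) ^ k := by
      rcases k with _ | k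
      · simp
      · rw [Nat.add_sub_cancel, pow_succ]; ring
    have hg0 := hg 0
    rw [multSum, ← add_sum_erase _ _ (show (0 : ℤ) ∈ Ioo (-N : ℤ) N by simp; lia)]
    simp only [zero_mul]
    calc multSum N k (fun _ => g 0) +
          ∑ h ∈ (Ioo (-N : ℤ) N).erase 0, multSum N k (fun m => g (h * m))
        ≤ (2 * N) ^ k * g 0 + ∑ h ∈ (Ioo (-N : ℤ) N).erase 0,
            (k * (2 * N) ^ (k - 1) * g 0 +
              C₁ * (N : ℝ) ^ (ε / 2) * ∑ m ∈ punctured (N ^ k), g (h * m)) := by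
          gcongr with h _
          · exact multSum_const_le N k hg0
          · simpa using h₁ N hN (fun m => g (h * m)) fun m => hg _
      _ ≤ (2 * N) ^ k * g 0 + (2 * N * (k * (2 * N) ^ (k - 1) * g 0) +
            C₁ * (N : ℝ) ^ (ε / 2) *
              (C₂ * (N : ℝ) ^ (ε / 2) * ∑ m ∈ punctured (N ^ (k + 1)), g m)) := by
          rw [sum_add_distrib, sum_const, nsmul_eq_mul, ← mul_sum]
          gcongr
          exact h₂ N hN g hg
      _ = _ := by
          rw [show 2 * (N : ℝ) * (k * (2 * N) ^ (k - 1) * g 0) =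
            k * (2 * N : ℝ) ^ (k - 1) * (2 * N) * g 0 by ring, hpow, Nat.add_sub_cancel,
            show C₁ * (N : ℝ) ^ (ε / 2) * (C₂ * (N : ℝ) ^ (ε / 2) *
              ∑ m ∈ punctured (N ^ (k + 1)), g m) = C₁ * C₂ * ((N : ℝ) ^ (ε / 2) *
              (N : ℝ) ^ (ε / 2)) * ∑ m ∈ punctured (N ^ (k + 1)), g m by ring,
            ← Real.rpow_add hN', add_halves]
          push_cast; ring

lemma sum_geomBound_le {N q : ℕ} (hN : 1 ≤ N) (hq : 1 ≤ q) :
    ∑ j ∈ range (2 * q), geomBound N (j / (2 * q)) ≤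
      2 * N + 4 * q * (1 + Real.log (2 * q)) := by
  have hq' : (0 : ℝ) < q := by exact_mod_cast hq
  have hN' : (0 : ℝ) < N := by exact_mod_cast hN
  obtain ⟨r, hr⟩ : ∃ r, 2 * q = r + 1 := ⟨2 * q - 1, by lia⟩
  have hr1 : 1 ≤ r := by lia
  have hrq : (r : ℝ) ≤ 2 * q := by exact_mod_cast (by lia : r ≤ 2 * q)
  rw [hr, sum_range_succ', add_comm]
  have h0 : geomBound N ((0 : ℕ) / (2 * q)) = 2 * N := by simp [geomBound]
  rw [h0]
  gcongr
  calc ∑ j ∈ range r, geomBound N ((j + 1 : ℕ) / (2 * q))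
      ≤ ∑ j ∈ range r, 4 * q * ((j : ℝ) + 1)⁻¹ := by
        refine sum_le_sum fun j _ => ?_
        rw [geomBound, div_le_iff₀ (by positivity)]
        push_cast
        have : 4 * (q : ℝ) * ((j : ℝ) + 1)⁻¹ * (1 + N * ((j + 1) / (2 * q))) =
          4 * (q : ℝ) * ((j : ℝ) + 1)⁻¹ + 2 * N := by field_simp; ring
        rw [this]
        have : 0 ≤ 4 * (q : ℝ) * ((j : ℝ) + 1)⁻¹ := by positivity
        linarith
    _ = 4 * q * (harmonic r : ℝ) := by
        rw [← mul_sum, harmonic]; push_cast; rfl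
    _ ≤ 4 * q * (1 + Real.log r) := by
        gcongr; exact harmonic_le_one_add_log r
    _ ≤ _ := by gcongr

lemma sum_geomBound_nid_le {ι : Type*} {N q : ℕ} (hN : 1 ≤ N) (hq : 1 ≤ q) (s : Finset ι)
    (x : ι → ℝ) (hx : ∀ i ∈ s, ∀ j ∈ s, i ≠ j → 1 / (2 * q) ≤ nid (x i - x j)) :
    ∑ i ∈ s, geomBound N (nid (x i)) ≤ 2 * (2 * N + 4 * q * (1 + Real.log (2 * q))) := by
  have hq' : (0 : ℝ) < q := by exact_mod_cast hq
  set b : ι → ℕ := fun i => ⌊2 * q * Int.fract (x i)⌋₊ with hb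
  have hpos : ∀ i, 0 ≤ 2 * q * Int.fract (x i) := fun i =>
    mul_nonneg (by positivity) (Int.fract_nonneg _)
  have hb1 : ∀ i, (b i : ℝ) ≤ 2 * q * Int.fract (x i) := fun i => Nat.floor_le (hpos i)
  have hb2 : ∀ i, 2 * q * Int.fract (x i) < b i + 1 := fun i => Nat.lt_floor_add_one _
  have hb3 : ∀ i, b i < 2 * q := fun i => by
    rw [hb, Nat.floor_lt (hpos i)]
    push_cast
    nlinarith [Int.fract_lt_one (x i)]
  have hinj : Set.InjOn b s := by
    intro i hi j hj hij
    by_contra hne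
    have h1 := hx i hi j hj hne
    have h2 : nid (x i - x j) ≤ |Int.fract (x i) - Int.fract (x j)| := by
      refine (nid_le_abs_sub_int _ (⌊x i⌋ - ⌊x j⌋)).trans_eq ?_
      rw [Int.fract, Int.fract]
      push_cast
      ring_nf
    have h3 : |Int.fract (x i) - Int.fract (x j)| < 1 / (2 * q) := by
      have hij' : (b i : ℝ) = b j := by exact_mod_cast hij
      rw [lt_div_iff₀ (by positivity), ← abs_of_pos (show (0 : ℝ) < 2 * q by positivity),
        ← abs_mul, abs_lt]
      constructor <;> nlinarith [hb1 i, hb1 j, hb2 i, hb2 j]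
    linarith
  have hterm : ∀ i ∈ s, geomBound N (nid (x i)) ≤
      geomBound N (b i / (2 * q)) + geomBound N ((2 * q - 1 - b i : ℕ) / (2 * q)) := by
    intro i _
    have hcast : ((2 * q - 1 - b i : ℕ) : ℝ) = 2 * q - 1 - b i := by
      rw [Nat.sub_sub, Nat.cast_sub (by have := hb3 i; lia)]; push_cast; ring
    have hA := geomBound_nonneg N (show (0 : ℝ) ≤ b i / (2 * q) by positivity)
    have hB := geomBound_nonneg N (show (0 : ℝ) ≤ (2 * q - 1 - b i : ℕ) / (2 * q) by positivity)
    rw [nid, abs_sub_round_eq_min]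
    rcases min_choice (Int.fract (x i)) (1 - Int.fract (x i)) with h | h <;> rw [h]
    · have := geomBound_anti N (show (0 : ℝ) ≤ b i / (2 * q) by positivity)
        ((div_le_iff₀' (by positivity)).2 (hb1 i))
      linarith
    · have := geomBound_anti N (show (0 : ℝ) ≤ (2 * q - 1 - b i : ℕ) / (2 * q) by positivity)
        (show ((2 * q - 1 - b i : ℕ) : ℝ) / (2 * q) ≤ 1 - Int.fract (x i) by
          rw [div_le_iff₀ (by positivity), hcast]
          linarith [hb2 i])
      linarith
  calc ∑ i ∈ s, geomBound N (nid (x i))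
      ≤ ∑ i ∈ s, (geomBound N (b i / (2 * q)) +
          geomBound N ((2 * q - 1 - b i : ℕ) / (2 * q))) := sum_le_sum hterm
    _ = ∑ j ∈ s.image b, (geomBound N (j / (2 * q)) +
          geomBound N ((2 * q - 1 - j : ℕ) / (2 * q))) := by rw [sum_image hinj]
    _ ≤ ∑ j ∈ range (2 * q), (geomBound N (j / (2 * q)) +
          geomBound N ((2 * q - 1 - j : ℕ) / (2 * q))) := by
        refine sum_le_sum_of_subset_of_nonneg ?_ fun j _ _ => ?_
        · intro j hj
          obtain ⟨i, _, rfl⟩ := mem_image.1 hj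
          exact mem_range.2 (hb3 i)
        · exact add_nonneg (geomBound_nonneg N (by positivity)) (geomBound_nonneg N (by positivity))
    _ = 2 * ∑ j ∈ range (2 * q), geomBound N (j / (2 * q)) := by
        rw [sum_add_distrib, sum_range_reflect (fun j : ℕ => geomBound N (j / (2 * q))), ← two_mul]
    _ ≤ _ := by gcongr; exact sum_geomBound_le hN hq

lemma sum_Icc_geomBound_le {N q M : ℕ} (hN : 1 ≤ N) (hq : 1 ≤ q) {β : ℝ}
    (hβ : ∀ j : ℕ, 0 < j → 2 * j ≤ q → 1 / (2 * q) ≤ nid (j * β)) :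
    ∑ m ∈ Icc 1 M, geomBound N (nid (m * β)) ≤
      (2 * M / q + 1) * (2 * (2 * N + 4 * q * (1 + Real.log (2 * q)))) := by
  have hq' : (0 : ℝ) < q := by exact_mod_cast hq
  set L := (q + 1) / 2 with hL
  have hL1 : 1 ≤ L := by lia
  have hL2 : (q : ℝ) ≤ 2 * L := by exact_mod_cast (by lia : q ≤ 2 * L)
  set R := 2 * (2 * N + 4 * q * (1 + Real.log (2 * q))) with hR
  have hR0 : 0 ≤ R := by
    have : 0 ≤ Real.log (2 * q) := Real.log_nonneg (by exact_mod_cast (by lia : 1 ≤ 2 * q))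
    positivity
  have hsep : ∀ i j : ℕ, j < i → i < j + L → 1 / (2 * q) ≤ nid (i * β - j * β) := by
    intro i j hij hji
    have := hβ (i - j) (by lia) (by lia)
    rwa [Nat.cast_sub hij.le, sub_mul] at this
  have hmaps : ∀ m ∈ Icc 1 M, m / L ∈ range (M / L + 1) := fun m hm => by
    rw [mem_range, Nat.lt_succ_iff]
    exact Nat.div_le_div_right (mem_Icc.1 hm).2
  rw [← sum_fiberwise_of_maps_to hmaps]
  calc ∑ t ∈ range (M / L + 1), ∑ m ∈ (Icc 1 M).filter (fun m => m / L = t),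
        geomBound N (nid (m * β)) ≤ ∑ t ∈ range (M / L + 1), R := by
        refine sum_le_sum fun t _ => sum_geomBound_nid_le hN hq _ _ fun i hi j hj hij => ?_
        have hi' := (mem_filter.1 hi).2
        have hj' := (mem_filter.1 hj).2
        have h1 : L * t ≤ i ∧ i < L * t + L := by
          rw [← hi']
          exact ⟨Nat.mul_div_le i L, Nat.lt_mul_div_succ i hL1⟩
        have h2 : L * t ≤ j ∧ j < L * t + L := by
          rw [← hj']
          exact ⟨Nat.mul_div_le j L, Nat.lt_mul_div_succ j hL1⟩
        rcases lt_or_gt_of_ne hij with h | h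
        · rw [← nid_neg, neg_sub]
          exact hsep j i h (by lia)
        · exact hsep i j h (by lia)
    _ = ((M / L : ℕ) + 1) * R := by simp
    _ ≤ _ := by
        gcongr
        calc ((M / L : ℕ) : ℝ) ≤ M / L := Nat.cast_div_le
          _ ≤ M / (q / 2) := by gcongr; linarith
          _ = _ := by field_simp

lemma sum_punctured_geomBound (N M : ℕ) (β : ℝ) :
    ∑ m ∈ punctured M, geomBound N (nid (m * β)) =
      2 * ∑ m ∈ Icc 1 M, geomBound N (nid (m * β)) := by
  have h : punctured M = (Icc 1 M).image (fun m : ℕ => (m : ℤ)) ∪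
      (Icc 1 M).image (fun m : ℕ => -(m : ℤ)) := by
    ext m
    simp only [mem_punctured, mem_union, mem_image, mem_Icc]
    constructor
    · intro hm
      rcases lt_or_gt_of_ne hm.1 with h | h
      · exact Or.inr ⟨m.natAbs, by lia, by lia⟩
      · exact Or.inl ⟨m.natAbs, by lia, by lia⟩
    · rintro (⟨n, hn, rfl⟩ | ⟨n, hn, rfl⟩) <;> lia
  rw [h, sum_union, sum_image, sum_image, two_mul]
  · congr 1
    refine sum_congr rfl fun m _ => ?_
    push_cast
    rw [neg_mul, nid_neg]
  · intro a _ b _ hab; simpa using hab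
  · intro a _ b _ hab; simpa using hab
  · rw [disjoint_left]
    intro m h1 h2
    simp only [mem_image, mem_Icc] at h1 h2
    lia

/-- Reduced Dirichlet approximations have small denominators only if a multiple is close to an
integer, and the multiples up to half the denominator are well separated from the integers. -/
lemma exists_denominator (β : ℝ) {X : ℕ} (hX : 1 ≤ X) :
    ∃ q : ℕ, 1 ≤ q ∧ q ≤ X ∧ nid (q * β) ≤ 1 / X ∧
      ∀ j : ℕ, 0 < j → 2 * j ≤ q → 1 / (2 * q) ≤ nid (j * β) := by
  obtain ⟨r, hr, hrX⟩ := Real.exists_rat_abs_sub_le_and_den_le β hX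
  have hq : (0 : ℝ) < r.den := by exact_mod_cast r.pos
  have hX' : (0 : ℝ) < X := by exact_mod_cast hX
  have hrX' : (r.den : ℝ) ≤ X := by exact_mod_cast hrX
  have hrr : (r : ℝ) = r.num / r.den := Rat.cast_def r
  refine ⟨r.den, r.pos, hrX, ?_, ?_⟩
  · refine (nid_le_abs_sub_int _ r.num).trans ?_
    have : (r.den : ℝ) * β - r.num = r.den * (β - r) := by rw [hrr]; field_simp
    rw [this, abs_mul, abs_of_pos hq]
    calc (r.den : ℝ) * |β - r| ≤ r.den * (1 / ((X + 1) * r.den)) := by gcongr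
      _ = 1 / (X + 1) := by field_simp
      _ ≤ 1 / X := by gcongr; linarith
  · intro j hj hjq
    have hj' : (0 : ℝ) < j := by exact_mod_cast hj
    have hjq' : 2 * (j : ℝ) ≤ r.den := by exact_mod_cast hjq
    set n := round ((j : ℝ) * β) with hn
    have h1 : 1 / (r.den : ℝ) ≤ |(j : ℝ) * r - n| := by
      have h2 : (j : ℝ) * r - n = ((j * r.num - n * r.den : ℤ) : ℝ) / r.den := by
        rw [hrr]; push_cast; field_simp
      rw [h2, abs_div, abs_of_pos hq]
      gcongr
      have h3 : (j * r.num - n * r.den : ℤ) ≠ 0 := by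
        intro h0
        have h4 : (r.den : ℤ) ∣ r.num * j := ⟨n, by linarith⟩
        have h5 : (r.den : ℤ) ∣ j := by
          refine IsCoprime.dvd_of_dvd_mul_left ?_ h4
          rw [Int.isCoprime_iff_gcd_eq_one, Int.gcd, Int.natAbs_natCast]
          exact r.reduced.symm
        have := Int.le_of_dvd (by exact_mod_cast hj) h5
        lia
      exact_mod_cast Int.one_le_abs h3
    have h2 : |(j : ℝ) * r - n| ≤ nid (j * β) + j * |β - r| := by
      have : (j : ℝ) * r - n = (j * β - n) + -(j * (β - r)) := by ring
      rw [this]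
      refine (abs_add_le _ _).trans_eq ?_
      rw [abs_neg, abs_mul, abs_of_pos hj', nid]
    have h3 : (j : ℝ) * |β - r| ≤ 1 / (2 * r.den) := by
      calc (j : ℝ) * |β - r| ≤ (r.den / 2) * (1 / ((X + 1) * r.den)) := by
            gcongr; linarith
        _ = 1 / (2 * (X + 1)) := by field_simp
        _ ≤ _ := by gcongr; linarith
    have h4 : 1 / (r.den : ℝ) = 2 * (1 / (2 * r.den)) := by field_simp
    linarith

lemma one_add_log_le {k N q : ℕ} (hN : 1 ≤ N) (hq : 1 ≤ q) (hqN : q ≤ N ^ k) {ε : ℝ} (hε : 0 < ε) :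
    1 + Real.log (2 * q) ≤ (2 + k / ε) * (N : ℝ) ^ ε := by
  have hN' : (1 : ℝ) ≤ N := by exact_mod_cast hN
  have hq' : (0 : ℝ) < q := by exact_mod_cast hq
  have hqN' : (q : ℝ) ≤ (N : ℝ) ^ k := by exact_mod_cast hqN
  have h1 : Real.log (2 * q) ≤ 1 + k * ((N : ℝ) ^ ε / ε) := by
    calc Real.log (2 * q) = Real.log 2 + Real.log q := Real.log_mul two_ne_zero hq'.ne'
      _ ≤ 1 + Real.log ((N : ℝ) ^ k) := by
        gcongr
        linarith [Real.log_two_lt_d9]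
      _ ≤ _ := by
        rw [Real.log_pow]
        gcongr
        exact Real.log_le_rpow_div (by positivity) hε
  have h2 : (1 : ℝ) ≤ (N : ℝ) ^ ε := Real.one_le_rpow hN' hε.le
  have h3 : (2 + k / ε) * (N : ℝ) ^ ε = 2 * (N : ℝ) ^ ε + k * ((N : ℝ) ^ ε / ε) := by ring
  linarith

/-- Weyl's inequality for phases with a denominator `q` attached to the top difference `c`. -/
lemma exists_norm_sum_pow_le {k : ℕ} (hk : 1 ≤ k) {ε : ℝ} (hε : 0 < ε) : ∃ C : ℝ, 0 < C ∧
    ∀ N : ℕ, 1 ≤ N → ∀ u v : ℤ, v - u ≤ N → ∀ (c : ℝ) (f : ℤ → ℝ), IsPhase (k + 1) c f →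
    ∀ q : ℕ, 1 ≤ q → q ≤ N ^ k →
    (∀ j : ℕ, 0 < j → 2 * j ≤ q → 1 / (2 * q : ℝ) ≤ nid (j * c)) →
    ‖∑ n ∈ Ico u v, unitExp (f n)‖ ^ 2 ^ k ≤
      C * (N : ℝ) ^ 2 ^ k * (N : ℝ) ^ ε * (1 / q + 1 / N) := by
  obtain ⟨C, hC, hmult⟩ := exists_multSum_le k (half_pos hε)
  set A : ℝ := 2 + k / (ε / 2) with hA
  have hA0 : 0 < A := by positivity
  have hA1 : 1 ≤ A := by
    have : (0 : ℝ) ≤ k / (ε / 2) := by positivity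
    linarith
  refine ⟨2 ^ (2 ^ k - k - 1) * (k * 2 ^ k + 48 * C * A), by positivity, ?_⟩
  intro N hN u v huv c f hf q hq hqN hsep
  have hN' : (1 : ℝ) ≤ N := by exact_mod_cast hN
  have hN0 : (0 : ℝ) < N := by linarith
  have hq' : (0 : ℝ) < q := by exact_mod_cast hq
  have hqN' : (q : ℝ) ≤ (N : ℝ) ^ k := by exact_mod_cast hqN
  set L : ℝ := (N : ℝ) ^ (ε / 2) with hL
  have hL1 : 1 ≤ L := Real.one_le_rpow hN' (half_pos hε).le
  have hLL : L * L = (N : ℝ) ^ ε := by rw [hL, ← Real.rpow_add hN0, add_halves]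
  set W : ℝ := 1 / q + 1 / N with hW
  have hW0 : 0 < W := by positivity
  have hlog : 1 + Real.log (2 * q) ≤ A * L := one_add_log_le hN hq hqN (half_pos hε)
  have hblock := sum_Icc_geomBound_le (M := N ^ k) hN hq hsep
  have hsum : ∑ m ∈ Icc 1 (N ^ k), geomBound N (nid (m * c)) ≤
      24 * A * L * ((N : ℝ) ^ (k + 1) * W) := by
    refine hblock.trans ?_
    have h1 : (2 * ((N ^ k : ℕ) : ℝ) / q + 1) ≤ 3 * (N : ℝ) ^ k / q := by
      rw [div_add_one hq'.ne']
      push_cast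
      gcongr
      linarith
    have h2 : 2 * (2 * N + 4 * q * (1 + Real.log (2 * q))) ≤ 8 * (A * L) * (N + q) := by
      have h3 : (1 : ℝ) ≤ A * L := one_le_mul_of_one_le_of_one_le hA1 hL1
      have h4 : 4 * q * (1 + Real.log (2 * q)) ≤ 4 * q * (A * L) := by gcongr
      have h5 : (N : ℝ) ≤ N * (A * L) := le_mul_of_one_le_right hN0.le h3
      linarith
    calc (2 * ((N ^ k : ℕ) : ℝ) / q + 1) * (2 * (2 * N + 4 * q * (1 + Real.log (2 * q))))
        ≤ 3 * (N : ℝ) ^ k / q * (8 * (A * L) * (N + q)) := by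
          have h3 : 0 ≤ Real.log (2 * q) :=
            Real.log_nonneg (by linarith [(by exact_mod_cast hq : (1 : ℝ) ≤ q)])
          gcongr
      _ = _ := by rw [hW]; field_simp; ring
  have h0 : geomBound N (nid ((0 : ℤ) * c)) = 2 * N := by simp [geomBound, nid]
  have hm := hmult N hN (fun m => geomBound N (nid (m * c)))
    fun m => geomBound_nonneg N (nid_nonneg _)
  rw [sum_punctured_geomBound, h0] at hm
  have hfirst : (k : ℝ) * (2 * N) ^ (k - 1) * (2 * N) ≤
      k * 2 ^ k * ((L * L) * ((N : ℝ) ^ (k + 1) * W)) := by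
    have h1 : (1 : ℝ) ≤ N * W := by
      rw [hW, mul_add, mul_one_div_cancel hN0.ne']
      have : 0 ≤ (N : ℝ) * (1 / q) := by positivity
      linarith
    calc (k : ℝ) * (2 * N) ^ (k - 1) * (2 * N) = k * 2 ^ k * (1 * 1 * ((N : ℝ) ^ k * 1)) := by
          rw [mul_assoc, pow_sub_one_mul (by lia), mul_pow]; ring
      _ ≤ k * 2 ^ k * (L * L * ((N : ℝ) ^ k * (N * W))) := by gcongr
      _ = _ := by ring
  have hmul : multSum N k (fun m => geomBound N (nid (m * c))) ≤
      (k * 2 ^ k + 48 * C * A) * ((L * L) * ((N : ℝ) ^ (k + 1) * W)) := by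
    calc _ ≤ _ := hm
      _ ≤ k * 2 ^ k * ((L * L) * ((N : ℝ) ^ (k + 1) * W)) +
          C * L * (2 * (24 * A * L * ((N : ℝ) ^ (k + 1) * W))) := by gcongr
      _ = _ := by ring
  have hpow : 2 ^ k - k - 1 + (k + 1) = 2 ^ k := by
    have := Nat.lt_two_pow_self (n := k)
    lia
  calc _ ≤ _ := norm_sum_unitExp_pow_le hN k huv hf
    _ ≤ (2 * N : ℝ) ^ (2 ^ k - k - 1) *
        ((k * 2 ^ k + 48 * C * A) * ((L * L) * ((N : ℝ) ^ (k + 1) * W))) := by gcongr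
    _ = 2 ^ (2 ^ k - k - 1) * (k * 2 ^ k + 48 * C * A) *
        ((N : ℝ) ^ (2 ^ k - k - 1) * (N : ℝ) ^ (k + 1)) * (L * L) * W := by rw [mul_pow]; ring
    _ = _ := by rw [← pow_add, hpow, hLL]

lemma sum_Icc_cast {M : Type*} [AddCommMonoid M] (N : ℕ) (g : ℤ → M) :
    ∑ n ∈ Icc 1 N, g n = ∑ n ∈ Ico (1 : ℤ) (N + 1), g n := by
  refine sum_nbij' (fun n => (n : ℤ)) Int.toNat ?_ ?_ ?_ ?_ ?_
  · intro n hn; rw [mem_Icc] at hn; rw [mem_Ico]; lia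
  · intro n hn; rw [mem_Ico] at hn; rw [mem_Icc]; lia
  · intro n _; exact Int.toNat_natCast n
  · intro n hn; rw [mem_Ico] at hn; lia
  · intro n _; rfl

lemma coeff_comp_linear {p : Polynomial ℝ} {d : ℕ} (hmonic : p.Monic) (hdeg : p.natDegree = d)
    {a : ℝ} (ha : a ≠ 0) (b : ℝ) :
    (p.comp (Polynomial.C a * Polynomial.X + Polynomial.C b)).natDegree = d ∧
      (p.comp (Polynomial.C a * Polynomial.X + Polynomial.C b)).coeff d = a ^ d := by
  have h1 : (Polynomial.C a * Polynomial.X + Polynomial.C b).natDegree = 1 :=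
    Polynomial.natDegree_linear ha
  refine ⟨by rw [Polynomial.natDegree_comp, h1, mul_one, hdeg], ?_⟩
  have h2 := Polynomial.coeff_comp_degree_mul_degree (p := p)
    (q := Polynomial.C a * Polynomial.X + Polynomial.C b) (by rw [h1]; exact one_ne_zero)
  rw [h1, mul_one, hmonic.leadingCoeff, one_mul, Polynomial.leadingCoeff_linear ha, hdeg] at h2
  exact h2

lemma IsFiniteTypeReal.exists_le {α t t' : ℝ} (hα : IsFiniteTypeReal α t) (ht' : t < t') :
    ∃ c : ℝ, 0 < c ∧ ∀ n : ℕ, 1 ≤ n → c ≤ (n : ℝ) ^ t' * nid (n * α) := by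
  obtain ⟨c, hc, h⟩ := hα (t' - t) (sub_pos.2 ht')
  refine ⟨c, hc, fun n hn => ?_⟩
  have h1 := h n (by lia)
  rwa [add_sub_cancel, Int.cast_natCast, Nat.abs_cast,
    max_eq_right (by exact_mod_cast hn : (1 : ℝ) ≤ n)] at h1

lemma exists_norm_sum_polynomial_le {p : Polynomial ℝ} {k : ℕ} (hk : 1 ≤ k) (hmonic : p.Monic)
    (hdeg : p.natDegree = k + 1) {α t t' : ℝ} (ht : 0 < t) (hα : IsFiniteTypeReal α t)
    (ht' : t < t') {ε : ℝ} (hε : 0 < ε) : ∃ C : ℝ, 0 < C ∧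
    ∀ (a : ℕ) (b : ℤ) (N h : ℕ), 1 ≤ a → 1 ≤ N → 1 ≤ h →
    ‖∑ n ∈ Icc 1 N, unitExp (h * (α * p.eval ((((a * n : ℕ) : ℤ) + b : ℤ) : ℝ)))‖ ^ 2 ^ k ≤
      C * (N : ℝ) ^ 2 ^ k * (N : ℝ) ^ ε *
        (h * ((N : ℝ) ^ (-1 : ℝ) + (a : ℝ) ^ (k + 1) * (N : ℝ) ^ (-(k / t')))) := by
  obtain ⟨C, hC, hweyl⟩ := exists_norm_sum_pow_le hk hε
  have ht0 : 0 < t' := ht.trans ht'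
  obtain ⟨c, hc, htype⟩ := hα.exists_le ht'
  set B : ℝ := (k + 1).factorial / c ^ (1 / t') with hB
  have hB0 : 0 < B := by positivity
  refine ⟨C * (B + 1), by positivity, fun a b N h ha hN hh => ?_⟩
  have hN' : (1 : ℝ) ≤ N := by exact_mod_cast hN
  have hN0 : (0 : ℝ) < N := by linarith
  have ha' : (1 : ℝ) ≤ a := by exact_mod_cast ha
  have hh' : (1 : ℝ) ≤ h := by exact_mod_cast hh
  set F : Polynomial ℝ := Polynomial.C (h * α) *
    p.comp (Polynomial.C (a : ℝ) * Polynomial.X + Polynomial.C (b : ℝ)) with hF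
  obtain ⟨h1, h2⟩ := coeff_comp_linear hmonic hdeg (show (a : ℝ) ≠ 0 by linarith) (b : ℝ)
  have hphase := isPhase_polynomial (k + 1) (f := F)
    ((Polynomial.natDegree_C_mul_le _ _).trans h1.le)
  rw [hF, Polynomial.coeff_C_mul, h2, ← hF] at hphase
  obtain ⟨q, hq, hqN, hqc, hsep⟩ := exists_denominator
    ((k + 1).factorial * (h * α * (a : ℝ) ^ (k + 1))) (Nat.one_le_pow k N hN)
  have hq0 : (0 : ℝ) < q := by exact_mod_cast hq
  have hsum : ∑ n ∈ Icc 1 N, unitExp (h * (α * p.eval ((((a * n : ℕ) : ℤ) + b : ℤ) : ℝ))) =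
      ∑ n ∈ Ico (1 : ℤ) (N + 1), unitExp (F.eval (n : ℝ)) := by
    rw [← sum_Icc_cast]
    refine sum_congr rfl fun n _ => ?_
    rw [hF]
    simp [mul_assoc]
  rw [hsum]
  refine (hweyl N hN 1 (N + 1) (by lia) _ _ hphase q hq hqN hsep).trans ?_
  have hqinv : 1 / (q : ℝ) ≤ B * (h * ((a : ℝ) ^ (k + 1) * (N : ℝ) ^ (-(k / t')))) := by
    set m : ℕ := q * ((k + 1).factorial * h * a ^ (k + 1)) with hm
    have hm1 : 1 ≤ m := by rw [hm]; exact Nat.one_le_iff_ne_zero.2 (by positivity)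
    have h3 := htype m hm1
    have h4 : (m : ℝ) * α = q * ((k + 1).factorial * (h * α * (a : ℝ) ^ (k + 1))) := by
      rw [hm]; push_cast; ring
    rw [h4] at h3
    have h5 : c * (N : ℝ) ^ (k : ℝ) ≤ (m : ℝ) ^ t' := by
      rw [Real.rpow_natCast, ← le_div_iff₀ (by positivity), div_eq_mul_one_div]
      refine h3.trans ?_
      gcongr
      exact_mod_cast hqc
    have h6 : c ^ (1 / t') * (N : ℝ) ^ (k / t') ≤ m := by
      calc c ^ (1 / t') * (N : ℝ) ^ (k / t') = (c * (N : ℝ) ^ (k : ℝ)) ^ (1 / t') := by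
            rw [Real.mul_rpow hc.le (by positivity), ← Real.rpow_mul hN0.le, mul_one_div]
        _ ≤ ((m : ℝ) ^ t') ^ (1 / t') := by gcongr
        _ = m := by rw [← Real.rpow_mul (by positivity), mul_one_div_cancel ht0.ne', Real.rpow_one]
    rw [hB, Real.rpow_neg hN0.le, div_le_iff₀ hq0]
    have h7 : (m : ℝ) = q * ((k + 1).factorial * h * (a : ℝ) ^ (k + 1)) := by
      rw [hm]; push_cast; ring
    have h8 : 1 ≤ (m : ℝ) / (c ^ (1 / t') * (N : ℝ) ^ (k / t')) :=
      (one_le_div (by positivity)).2 h6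
    refine h8.trans_eq ?_
    rw [h7]
    field_simp
  have hW : 1 / (q : ℝ) + 1 / N ≤
      (B + 1) * (h * ((N : ℝ) ^ (-1 : ℝ) + (a : ℝ) ^ (k + 1) * (N : ℝ) ^ (-(k / t')))) := by
    rw [Real.rpow_neg_one, ← one_div]
    have h3 : 1 / (N : ℝ) ≤ h * (1 / N) := le_mul_of_one_le_left (by positivity) hh'
    have h4 : 0 ≤ B * (h * (1 / (N : ℝ))) := by positivity
    have h5 : 0 ≤ h * ((a : ℝ) ^ (k + 1) * (N : ℝ) ^ (-(k / t'))) := by positivity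
    linarith
  calc _ ≤ C * (N : ℝ) ^ 2 ^ k * (N : ℝ) ^ ε * ((B + 1) *
        (h * ((N : ℝ) ^ (-1 : ℝ) + (a : ℝ) ^ (k + 1) * (N : ℝ) ^ (-(k / t'))))) := by gcongr
    _ = _ := by ring

/-- An optimised discrepancy bound from a bound on the `K`-th powers of all exponential sums. -/
lemma exists_disc_le_of_norm_sum_pow_le {K : ℕ} (hK : 2 ≤ K) {e : ℝ} (he : 0 < e) (he1 : e ≤ 1 / 2)
    {C : ℝ} (hC : 0 < C) : ∃ C' : ℝ, 0 < C' ∧ ∀ (N : ℕ) (u : ℕ → ℝ) (V : ℝ), 1 ≤ N →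
      (N : ℝ) ^ (-1 : ℝ) ≤ V →
      (∀ h : ℕ, 1 ≤ h → ‖∑ n ∈ Icc 1 N, unitExp (h * u n)‖ ^ K ≤
        C * (N : ℝ) ^ K * (N : ℝ) ^ e * (h * V)) →
      disc N u ≤ C' * (N : ℝ) ^ (2 * e) * V ^ (1 / (K + 1) : ℝ) := by
  have hK' : (2 : ℝ) ≤ K := by exact_mod_cast hK
  set s : ℝ := 1 / K with hs
  have hs0 : 0 < s := by positivity
  have hs1 : s ≤ 1 / 2 := one_div_le_one_div_of_le two_pos hK'
  set Z : ℝ := ∑' k : ℕ, (k : ℝ) ^ (-(1 + e)) with hZ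
  have hZ0 : 0 ≤ Z := tsum_nonneg fun k => by positivity
  refine ⟨2 * (1 + C ^ s * Z), by positivity, fun N u V hN hV hsum => ?_⟩
  have hN' : (1 : ℝ) ≤ N := by exact_mod_cast hN
  have hN0 : (0 : ℝ) < N := by linarith
  have hV0 : 0 < V := lt_of_lt_of_le (by positivity) hV
  have hNe : (1 : ℝ) ≤ (N : ℝ) ^ (2 * e) := Real.one_le_rpow hN' (by linarith)
  set δ : ℝ := V ^ (1 / (K + 1) : ℝ) with hδ
  have hδ0 : 0 < δ := by positivity
  rcases le_total 1 V with hV1 | hV1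
  · have h1 : 1 ≤ δ := Real.one_le_rpow hV1 (by positivity)
    have h2 : (1 : ℝ) ≤ 2 * (1 + C ^ s * Z) := by
      have : 0 ≤ C ^ s * Z := by positivity
      linarith
    calc disc N u ≤ 1 * 1 * 1 := by rw [mul_one, mul_one]; exact disc_le_one
      _ ≤ _ := by gcongr
  have hδ1 : δ ≤ 1 := Real.rpow_le_one hV0.le hV1 (by positivity)
  have hNδ : (N : ℝ) ^ (-1 : ℝ) ≤ δ := by
    refine hV.trans (Real.self_le_rpow_of_le_one hV0.le hV1 ?_)
    rw [div_le_one (by positivity)]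
    linarith
  set E : ℝ := (C * (N : ℝ) ^ e * V) ^ s with hE
  have hE0 : 0 < E := by positivity
  have hbound : ∀ h : ℕ, 1 ≤ h →
      ‖∑ n ∈ Icc 1 N, unitExp (h * u n)‖ ≤ N * (E * (h : ℝ) ^ s) := by
    intro h hh
    rw [← pow_le_pow_iff_left₀ (norm_nonneg _) (by positivity) (by lia : K ≠ 0)]
    refine (hsum h hh).trans_eq ?_
    have hroot : ∀ x : ℝ, 0 ≤ x → (x ^ s) ^ K = x := fun x hx => by
      rw [hs, one_div, Real.rpow_inv_natCast_pow hx (by lia)]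
    rw [mul_pow, mul_pow, hE, hroot _ (by positivity), hroot _ (by positivity)]
    ring
  refine (disc_le_of_norm_sum_le hN hs0.le he (by linarith) hδ0 hδ1 hbound).trans ?_
  have hVδ : V ^ s * δ ^ (-s) = δ := by
    rw [hδ, ← Real.rpow_mul hV0.le, ← Real.rpow_add hV0]
    congr 1
    rw [hs]
    field_simp
    ring
  have hδe : δ ^ (-e) ≤ (N : ℝ) ^ e := by
    calc δ ^ (-e) ≤ ((N : ℝ) ^ (-1 : ℝ)) ^ (-e) :=
          Real.rpow_le_rpow_of_nonpos (by positivity) hNδ (by linarith)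
      _ = (N : ℝ) ^ e := by rw [← Real.rpow_mul hN0.le]; congr 1; ring
  have hNes : ((N : ℝ) ^ e) ^ s ≤ (N : ℝ) ^ e := by
    rw [← Real.rpow_mul hN0.le]
    exact Real.rpow_le_rpow_of_exponent_le hN' (by nlinarith)
  have hmain : E * δ ^ (-(s + e)) ≤ C ^ s * (N : ℝ) ^ (2 * e) * δ := by
    calc E * δ ^ (-(s + e)) = C ^ s * (((N : ℝ) ^ e) ^ s * δ ^ (-e)) * (V ^ s * δ ^ (-s)) := by
          rw [hE, Real.mul_rpow (by positivity) (by positivity),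
            Real.mul_rpow (by positivity) (by positivity), neg_add, Real.rpow_add hδ0]
          ring
      _ ≤ C ^ s * ((N : ℝ) ^ e * (N : ℝ) ^ e) * δ := by rw [hVδ]; gcongr
      _ = _ := by rw [← Real.rpow_add hN0, two_mul]
  have hδN : δ ≤ (N : ℝ) ^ (2 * e) * δ := le_mul_of_one_le_left hδ0.le hNe
  calc 2 * (δ + E * δ ^ (-(s + e)) * Z)
      ≤ 2 * ((N : ℝ) ^ (2 * e) * δ + C ^ s * (N : ℝ) ^ (2 * e) * δ * Z) := by gcongr
    _ = _ := by ring

lemma exists_disc_polynomial_le {p : Polynomial ℝ} {k : ℕ} (hk : 1 ≤ k) (hmonic : p.Monic)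
    (hdeg : p.natDegree = k + 1) {α t : ℝ} (ht : 0 < t) (hα : IsFiniteTypeReal α t)
    {ε : ℝ} (hε : 0 < ε) : ∃ C : ℝ, 0 < C ∧ ∀ (a : ℕ) (b : ℤ) (N : ℕ), 1 ≤ a → 1 ≤ N →
    disc N (fun n => α * p.eval ((((a * n : ℕ) : ℤ) + b : ℤ) : ℝ)) ≤
      C * (N : ℝ) ^ ε *
        ((N : ℝ) ^ (-1 : ℝ) + (a : ℝ) ^ (k + 1) * (N : ℝ) ^ (-(k / t))) ^ (1 / (2 ^ k + 1) : ℝ) := by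
  set e : ℝ := min (1 / 2) (ε / (2 + k / t ^ 2)) with he
  have he0 : 0 < e := lt_min (by norm_num) (by positivity)
  have heε : 2 * e + k * e / t ^ 2 ≤ ε := by
    have : e ≤ ε / (2 + k / t ^ 2) := min_le_right _ _
    rw [le_div_iff₀ (by positivity)] at this
    calc 2 * e + k * e / t ^ 2 = e * (2 + k / t ^ 2) := by ring
      _ ≤ ε := this
  obtain ⟨C, hC, hsum⟩ := exists_norm_sum_polynomial_le hk hmonic hdeg ht hα
    (lt_add_of_pos_right t he0) he0
  obtain ⟨C', hC', hdisc⟩ := exists_disc_le_of_norm_sum_pow_le (K := 2 ^ k)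
    (by calc 2 = 2 ^ 1 := rfl
          _ ≤ 2 ^ k := Nat.pow_le_pow_right two_pos hk) he0 (min_le_left _ _) hC
  refine ⟨C', hC', fun a b N ha hN => ?_⟩
  have hN' : (1 : ℝ) ≤ N := by exact_mod_cast hN
  have hN0 : (0 : ℝ) < N := by linarith
  set V : ℝ := (N : ℝ) ^ (-1 : ℝ) + (a : ℝ) ^ (k + 1) * (N : ℝ) ^ (-(k / t)) with hV
  have hV0 : 0 < V := by positivity
  have hγ : 0 ≤ k * e / t ^ 2 := by positivity
  have hexp : -(k / (t + e)) ≤ k * e / t ^ 2 + -(k / t) := by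
    have h1 : k * e / t ^ 2 + -(k / t) - -(k / (t + e)) = k * e ^ 2 / (t ^ 2 * (t + e)) := by
      field_simp
      ring
    have h2 : 0 ≤ k * e ^ 2 / (t ^ 2 * (t + e)) := by positivity
    linarith
  have hVle : (N : ℝ) ^ (-1 : ℝ) + (a : ℝ) ^ (k + 1) * (N : ℝ) ^ (-(k / (t + e))) ≤
      (N : ℝ) ^ (k * e / t ^ 2) * V := by
    rw [hV, mul_add, mul_left_comm, ← Real.rpow_add hN0 _ (-(k / t))]
    have h1 : (1 : ℝ) ≤ (N : ℝ) ^ (k * e / t ^ 2) := Real.one_le_rpow hN' hγ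
    gcongr
    exact le_mul_of_one_le_left (by positivity) h1
  have hKle : (1 / (2 ^ k + 1) : ℝ) ≤ 1 := by
    rw [div_le_one (by positivity)]
    linarith [(by positivity : (0 : ℝ) < 2 ^ k)]
  have h1 := hdisc N (fun n => α * p.eval ((((a * n : ℕ) : ℤ) + b : ℤ) : ℝ)) _ hN
    (le_add_of_nonneg_right (by positivity)) fun h hh => hsum a b N h ha hN hh
  refine h1.trans ?_
  push_cast
  calc C' * (N : ℝ) ^ (2 * e) *
        ((N : ℝ) ^ (-1 : ℝ) + (a : ℝ) ^ (k + 1) * (N : ℝ) ^ (-(k / (t + e)))) ^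
          (1 / (2 ^ k + 1) : ℝ)
      ≤ C' * (N : ℝ) ^ (2 * e) * ((N : ℝ) ^ (k * e / t ^ 2) * V) ^ (1 / (2 ^ k + 1) : ℝ) := by
        gcongr
    _ ≤ C' * (N : ℝ) ^ (2 * e) * ((N : ℝ) ^ (k * e / t ^ 2) * V ^ (1 / (2 ^ k + 1) : ℝ)) := by
        rw [Real.mul_rpow (by positivity) hV0.le, ← Real.rpow_mul hN0.le]
        gcongr
        exact mul_le_of_le_one_right hγ hKle
    _ = C' * (N : ℝ) ^ (2 * e + k * e / t ^ 2) * V ^ (1 / (2 ^ k + 1) : ℝ) := by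
        rw [Real.rpow_add hN0]; ring
    _ ≤ _ := by gcongr

lemma IsFiniteTypeReal.one_le {α t : ℝ} (ht : 0 < t) (hα : IsFiniteTypeReal α t) : 1 ≤ t := by
  by_contra! h
  obtain ⟨c, hc, htype⟩ := hα.exists_le (t' := (t + 1) / 2) (by linarith)
  obtain ⟨X, hX⟩ := exists_nat_gt ((1 / c) ^ (1 / (1 - (t + 1) / 2)))
  have hX0 : (0 : ℝ) < X := lt_of_le_of_lt (by positivity) hX
  obtain ⟨q, hq, hqX, hqα, -⟩ := exists_denominator α (X := X) (by exact_mod_cast hX0)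
  have hqX' : (q : ℝ) ≤ X := by exact_mod_cast hqX
  have h1 : c ≤ (X : ℝ) ^ ((t + 1) / 2) * (1 / X) := by
    refine (htype q hq).trans ?_
    have := nid_nonneg (q * α)
    gcongr
  have h2 : 1 / c < (X : ℝ) ^ (1 - (t + 1) / 2) := by
    calc 1 / c = ((1 / c) ^ (1 / (1 - (t + 1) / 2))) ^ (1 - (t + 1) / 2) := by
          rw [← Real.rpow_mul (by positivity), one_div_mul_cancel (by linarith), Real.rpow_one]
      _ < _ := Real.rpow_lt_rpow (by positivity) hX (by linarith)
  rw [div_lt_iff₀ hc, Real.rpow_sub hX0, Real.rpow_one] at h2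
  have h3 : (X : ℝ) / (X : ℝ) ^ ((t + 1) / 2) * c ≤
      X / (X : ℝ) ^ ((t + 1) / 2) * ((X : ℝ) ^ ((t + 1) / 2) * (1 / X)) := by gcongr
  have h4 : (X : ℝ) / (X : ℝ) ^ ((t + 1) / 2) * ((X : ℝ) ^ ((t + 1) / 2) * (1 / X)) = 1 := by
    field_simp
  linarith

lemma le_rpow_mul_rpow {D C t ε : ℝ} {a N k : ℕ} (ha : 1 ≤ a) (hN : 1 ≤ N) (hk : 1 ≤ k)
    (ht : 1 ≤ t) (hε : 0 < ε) (hC : 0 < C) (hD1 : D ≤ 1)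
    (hD : D ≤ C * (N : ℝ) ^ ε *
      ((N : ℝ) ^ (-1 : ℝ) + (a : ℝ) ^ (k + 1) * (N : ℝ) ^ (-(k / t))) ^ (1 / (2 ^ k + 1) : ℝ)) :
    D ≤ (2 * C + 1) * (a : ℝ) ^ (((k : ℝ) + 1) * t / (2 ^ k * (t + 1) + t) + ε) *
      (N : ℝ) ^ (-(2 - 2 / 2 ^ k) / (2 ^ k * (2 * t + 1) + t) + ε) := by
  have hN' : (1 : ℝ) ≤ N := by exact_mod_cast hN
  have hN0 : (0 : ℝ) < N := by linarith
  have ha' : (1 : ℝ) ≤ a := by exact_mod_cast ha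
  have ha0 : (0 : ℝ) < a := by linarith
  have hK2 : (2 : ℝ) ≤ 2 ^ k := by
    simpa using pow_le_pow_right₀ (one_le_two (α := ℝ)) hk
  have hσk : 2 - 2 / (2 : ℝ) ^ k ≤ k := by
    rcases hk.eq_or_lt with rfl | hk2
    · norm_num
    · have h1 : (2 : ℝ) ≤ k := by exact_mod_cast hk2
      have h2 : 0 ≤ 2 / (2 : ℝ) ^ k := by positivity
      linarith
  set K : ℝ := 2 ^ k with hK
  set Q : ℝ := K * (t + 1) + t with hQ
  set R : ℝ := K * (2 * t + 1) + t with hR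
  set σ : ℝ := 2 - 2 / K with hσ
  have hQ0 : 0 < Q := by positivity
  have hR0 : 0 < R := by positivity
  have hQR : Q ≤ R := by
    have : 0 ≤ K * t := by positivity
    linarith
  set Y : ℝ := (a : ℝ) ^ (k + 1) * (N : ℝ) ^ (-(k / t)) with hY
  have hY0 : 0 < Y := by positivity
  have hYpow : Y ^ (t / Q) ≤ (a : ℝ) ^ (((k : ℝ) + 1) * t / Q) * (N : ℝ) ^ (-σ / R) := by
    rw [hY, Real.mul_rpow (by positivity) (by positivity), ← Real.rpow_natCast,
      ← Real.rpow_mul ha0.le, ← Real.rpow_mul hN0.le]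
    push_cast
    rw [mul_div_assoc]
    gcongr ?_ * ?_
    refine Real.rpow_le_rpow_of_exponent_le hN' ?_
    have h1 : -(k / t) * (t / Q) = -(k / Q) := by field_simp
    have h2 : σ / R ≤ k / Q := by gcongr
    rw [h1, neg_div]
    linarith
  have hNexp : ((N : ℝ) ^ (-1 : ℝ)) ^ (1 / (K + 1)) ≤ (N : ℝ) ^ (-σ / R) := by
    rw [← Real.rpow_mul hN0.le]
    refine Real.rpow_le_rpow_of_exponent_le hN' ?_
    have h1 : σ / R ≤ 1 / (K + 1) := by
      rw [div_le_div_iff₀ hR0 (by positivity)]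
      have h2 : σ * (K + 1) = 2 * K - 2 / K := by rw [hσ]; field_simp; ring
      have h3 : 0 ≤ 2 / K := by positivity
      have h4 : K * 3 ≤ K * (2 * t + 1) := by gcongr; linarith
      linarith
    rw [neg_one_mul, neg_div]
    linarith
  have haε : (1 : ℝ) ≤ (a : ℝ) ^ ε := Real.one_le_rpow ha' hε.le
  have hNε : (1 : ℝ) ≤ (N : ℝ) ^ ε := Real.one_le_rpow hN' hε.le
  have haQ : (1 : ℝ) ≤ (a : ℝ) ^ (((k : ℝ) + 1) * t / Q) := Real.one_le_rpow ha' (by positivity)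
  set P : ℝ := (a : ℝ) ^ (((k : ℝ) + 1) * t / Q) * (N : ℝ) ^ (-σ / R) with hP
  have hP0 : 0 < P := by positivity
  have hgoal : (2 * C + 1) * (a : ℝ) ^ (((k : ℝ) + 1) * t / Q + ε) * (N : ℝ) ^ (-σ / R + ε) =
      (2 * C + 1) * (a ^ ε * N ^ ε) * P := by
    rw [Real.rpow_add ha0, Real.rpow_add hN0, hP]; ring
  rw [hgoal]
  rcases le_total 1 Y with h1 | h1
  · calc D ≤ 1 * (1 * 1) * 1 := by linarith
      _ ≤ (2 * C + 1) * (a ^ ε * N ^ ε) * P := by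
        have h2 : 1 ≤ P := (Real.one_le_rpow h1 (by positivity)).trans hYpow
        gcongr
        linarith
  · have hYexp : Y ^ (1 / (K + 1)) ≤ Y ^ (t / Q) := by
      refine Real.rpow_le_rpow_of_exponent_ge hY0 h1 ?_
      rw [div_le_div_iff₀ hQ0 (by positivity)]
      nlinarith
    have h2 : ((N : ℝ) ^ (-1 : ℝ) + Y) ^ (1 / (K + 1)) ≤ 2 * P := by
      calc _ ≤ ((N : ℝ) ^ (-1 : ℝ)) ^ (1 / (K + 1)) + Y ^ (1 / (K + 1)) :=
            Real.rpow_add_le_add_rpow (by positivity) hY0.le (by positivity)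
              ((div_le_one (by positivity)).2 (by linarith))
        _ ≤ P + P := by
            gcongr
            · exact hNexp.trans (le_mul_of_one_le_left (by positivity) haQ)
            · exact hYexp.trans hYpow
        _ = 2 * P := by ring
    calc D ≤ C * (N : ℝ) ^ ε * (2 * P) := hD.trans (by gcongr)
      _ = (2 * C) * (1 * N ^ ε) * P := by ring
      _ ≤ (2 * C + 1) * (a ^ ε * N ^ ε) * P := by
        gcongr
        linarith

/-- Proposition (basis case): discrepancy estimate for `(α·p(an+b))_{n=1}^N`. -/
theorem discrepancy_basis_case (p : Polynomial ℝ) (d : ℕ) (hd : 2 ≤ d)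
    (hmonic : p.Monic) (hdeg : p.natDegree = d)
    (α t : ℝ) (ht : 0 < t) (hα : IsFiniteTypeReal α t)
    (ε : ℝ) (hε : 0 < ε) :
    ∃ C > 0, ∀ (a : ℕ) (b : ℤ) (N : ℕ), 1 ≤ a → 1 ≤ N →
      (a : ℝ) ≤ (N : ℝ) ^ ((2 - (2 : ℝ) ^ (2 - (d : ℝ))) / ((d : ℝ) * t)) →
      disc N (fun n => α * p.eval ((((a * n : ℕ) : ℤ) + b : ℤ) : ℝ)) ≤
        C * (a : ℝ) ^ ((d : ℝ) * t / ((2 : ℝ) ^ ((d : ℝ) - 1) * (t + 1) + t) + ε) *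
          (N : ℝ) ^ (-(2 - (2 : ℝ) ^ (2 - (d : ℝ))) / ((2 : ℝ) ^ ((d : ℝ) - 1) * (2 * t + 1) + t) + ε) := by
  obtain ⟨k, rfl⟩ : ∃ k, d = k + 1 := ⟨d - 1, by lia⟩
  have hk : 1 ≤ k := by lia
  obtain ⟨C, hC, hdisc⟩ := exists_disc_polynomial_le hk hmonic hdeg ht hα hε
  refine ⟨2 * C + 1, by positivity, fun a b N ha hN _ => ?_⟩
  have hK : (2 : ℝ) ^ (((k + 1 : ℕ) : ℝ) - 1) = 2 ^ k := by
    rw [Nat.cast_add_one, add_sub_cancel_right, Real.rpow_natCast]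
  have hσ : (2 : ℝ) ^ (2 - ((k + 1 : ℕ) : ℝ)) = 2 / 2 ^ k := by
    rw [Nat.cast_add_one, show (2 : ℝ) - (k + 1) = 1 - k by ring, Real.rpow_sub two_pos,
      Real.rpow_one, Real.rpow_natCast]
  rw [hK, hσ, Nat.cast_add_one]
  exact le_rpow_mul_rpow ha hN hk (hα.one_le ht) hε hC disc_le_one (hdisc a b N ha hN)
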